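/- arXiv:1608.07926 — 5 statements merged into one kernel-verified Lean document; each statement's English description precedes it below -/
import Mathlib

section
/- Let F_r be the free group on generators x_1, …, x_r, let i be one of the indices, let c be a nonzero integer, and let w ∈ F_r be an element conjugate to x_i^c, i.e. w = z·x_i^c·z⁻¹ for some z ∈ F_r. Then there exists a unique y ∈ F_r such that w = y·x_i^c·y⁻¹ and σ_i(y) = 0. (Discrete-group form of Lemma 2.2.1: existence and uniqueness of the preferred longitude.) -/
/-- The `x_i`-exponent sum homomorphism `σ_i : F_r → ℤ` (written multiplicatively). -/
def expSum {r : ℕ} (i : Fin r) : FreeGroup (Fin r) →* Multiplicative ℤ :=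
  FreeGroup.lift fun j => Multiplicative.ofAdd (if j = i then (1 : ℤ) else 0)

namespace FreeGroup

variable {α : Type*}

theorem mk_mem_zpowers_of_commute_pow {a : α} {n : ℕ} (hn : n ≠ 0) {L : List (α × Bool)}
    (hL : IsReduced L) (h : Commute (mk L) (of a ^ n)) : mk L ∈ Subgroup.zpowers (of a) := by
  classical
  induction L with
  | nil => exact one_mem _
  | cons p L ih =>
    obtain ⟨b, s⟩ := p
    have hmul : mk ((b, s) :: L) = mk [(b, s)] * mk L := by rw [mul_mk]; rfl
    have hLred : IsReduced L := List.IsChain.tail hL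
    by_cases hb : b = a
    · subst hb
      have hs : mk [(b, s)] ∈ Subgroup.zpowers (of b) := by
        cases s
        · exact inv_mem (Subgroup.mem_zpowers (of b))
        · exact Subgroup.mem_zpowers (of b)
      have hcomm : Commute (mk [(b, s)]) (of b ^ n) := by
        obtain ⟨k, hk⟩ := hs
        rw [← hk]
        exact ((Commute.refl (of b)).zpow_left k).pow_right n
      rw [hmul] at h ⊢
      refine mul_mem hs (ih hLred ?_)
      simpa only [inv_mul_cancel_left] using hcomm.inv_left.mul_left h
    · exfalso
      have hred : IsReduced (List.replicate n (a, true) ++ (b, s) :: L) := by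
        refine List.isChain_append.2 ⟨List.isChain_replicate_of_rel n fun _ => rfl, hL, ?_⟩
        intro x hx y hy hxy
        rw [List.getLast?_replicate, if_neg hn] at hx
        simp only [Option.mem_def, Option.some.injEq, List.head?_cons] at hx hy
        subst hx hy
        exact absurd hxy.symm hb
      have hpow : of a ^ n = mk (List.replicate n (a, true)) := by
        rw [← mk_toWord (x := of a ^ n), toWord_of_pow]
      rw [hpow, Commute, SemiconjBy, mul_mk, mul_mk] at h
      have hsub := (reduce.red (L := (b, s) :: L ++ List.replicate n (a, true))).sublist
      have hwords := congrArg toWord h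
      rw [toWord_mk, toWord_mk, hred.reduce_eq] at hwords
      rw [hwords] at hsub
      have heq := hsub.eq_of_length (by simp only [List.length_append, add_comm])
      obtain ⟨m, rfl⟩ := Nat.exists_eq_succ_of_ne_zero hn
      simp only [Nat.succ_eq_add_one, List.replicate_succ, List.cons_append, List.cons.injEq,
        Prod.mk.injEq] at heq
      exact hb heq.1.1.symm

theorem mem_zpowers_of_commute_zpow {a : α} {c : ℤ} (hc : c ≠ 0) {x : FreeGroup α}
    (h : Commute x (of a ^ c)) : x ∈ Subgroup.zpowers (of a) := by
  classical
  rw [← mk_toWord (x := x)]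
  refine mk_mem_zpowers_of_commute_pow (Int.natAbs_ne_zero.2 hc) isReduced_toWord ?_
  rw [mk_toWord]
  rcases Int.natAbs_eq c with hc' | hc' <;> rw [hc'] at h
  · simpa only [zpow_natCast] using h
  · simpa only [zpow_neg, zpow_natCast, Commute.inv_right_iff] using h

end FreeGroup

theorem expSum_of_zpow {r : ℕ} (i : Fin r) (k : ℤ) :
    expSum i (FreeGroup.of i ^ k) = Multiplicative.ofAdd k := by
  rw [map_zpow, expSum, FreeGroup.lift_apply_of, if_pos rfl, ← ofAdd_zsmul, smul_eq_mul, mul_one]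

/-- Discrete-group form of Lemma 2.2.1: existence and uniqueness of the preferred
longitude. -/
theorem preferred_longitude_existsUnique {r : ℕ} (i : Fin r) (c : ℤ) (hc : c ≠ 0)
    (w z : FreeGroup (Fin r)) (hw : w = z * FreeGroup.of i ^ c * z⁻¹) :
    ∃! y : FreeGroup (Fin r),
      w = y * FreeGroup.of i ^ c * y⁻¹ ∧ expSum i y = 1 := by
  subst hw
  set k : ℤ := Multiplicative.toAdd (expSum i z) with hk
  refine ⟨z * FreeGroup.of i ^ (-k), ⟨by group, ?_⟩, ?_⟩
  · rw [map_mul, expSum_of_zpow, ofAdd_neg, hk, ofAdd_toAdd, mul_inv_cancel]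
  · rintro y ⟨hy, hy1⟩
    have hcomm : Commute (z⁻¹ * y) (FreeGroup.of i ^ c) := by
      have hmul := congrArg (fun t => z⁻¹ * t * y) hy
      simp only [mul_assoc, inv_mul_cancel_left, inv_mul_cancel, mul_one] at hmul
      rw [Commute, SemiconjBy, mul_assoc, hmul]
    obtain ⟨m, hm⟩ := FreeGroup.mem_zpowers_of_commute_zpow hc hcomm
    have hym : y = z * FreeGroup.of i ^ m := by
      rw [show FreeGroup.of i ^ m = z⁻¹ * y from hm, mul_inv_cancel_left]
    rw [hym, map_mul, expSum_of_zpow] at hy1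
    have hsum : k + m = 0 := congrArg Multiplicative.toAdd hy1
    rw [hym, eq_neg_of_add_eq_zero_right hsum]
end

section
/- For every h ∈ Γ and every index i, the preferred longitudes satisfy y_i(h⁻¹) = ρ(h⁻¹)(y_i(h))⁻¹. (Discrete-group form of Lemma 2.2.5(1).) -/
/-- A commutative free group has at most one generator. -/
theorem FreeGroup.subsingleton_of_commute {α : Type*}
    (hcomm : ∀ u v : FreeGroup α, Commute u v) : Subsingleton α := by
  classical
  refine ⟨fun a b => ?_⟩
  have h := congrArg FreeGroup.toWord (hcomm (FreeGroup.of a) (FreeGroup.of b)).eq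
  simp [FreeGroup.toWord_mul, FreeGroup.reduce.cons] at h
  exact h.1

/-- A commutative free group is cyclic. -/
theorem FreeGroup.isCyclic_of_commute {α : Type*}
    (hcomm : ∀ u v : FreeGroup α, Commute u v) : IsCyclic (FreeGroup α) := by
  have := FreeGroup.subsingleton_of_commute hcomm
  rcases isEmpty_or_nonempty α with _ | ⟨⟨a⟩⟩
  · infer_instance
  · have := uniqueOfSubsingleton a
    infer_instance

/-- Commuting elements of a free group are powers of a common element. -/
theorem FreeGroup.exists_zpow_of_commute {α : Type*} {u v : FreeGroup α} (h : Commute u v) :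
    ∃ (t : FreeGroup α) (m n : ℤ), t ^ m = u ∧ t ^ n = v := by
  let H : Subgroup (FreeGroup α) := Subgroup.closure {u, v}
  have hH : IsMulCommutative H := Subgroup.isMulCommutative_closure (by
    rintro a (rfl | rfl) b (rfl | rfl)
    exacts [rfl, h.eq, h.eq.symm, rfl])
  have hc : ∀ a b : H, Commute a b := fun a b => hH.is_comm.comm a b
  have e := IsFreeGroup.toFreeGroup H
  have hcyc := FreeGroup.isCyclic_of_commute
    (fun a b => by simpa using (hc (e.symm a) (e.symm b)).map e)
  obtain ⟨t, ht⟩ := (isCyclic_of_surjective e.symm e.symm.surjective).exists_generator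
  obtain ⟨m, hm⟩ := ht ⟨u, Subgroup.subset_closure (by simp)⟩
  obtain ⟨n, hn⟩ := ht ⟨v, Subgroup.subset_closure (by simp)⟩
  exact ⟨t, m, n, by simpa using congrArg Subtype.val hm, by simpa using congrArg Subtype.val hn⟩

theorem expSum_of_self {r : ℕ} (i : Fin r) :
    expSum i (FreeGroup.of i) = Multiplicative.ofAdd 1 := by
  simp [expSum]

/-- An element commuting with `x_i` and with trivial `x_i`-exponent sum is trivial. -/
theorem eq_one_of_commute_of_expSum_eq_one {r : ℕ} {i : Fin r} {w : FreeGroup (Fin r)}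
    (hw : Commute w (FreeGroup.of i)) (hσ : expSum i w = 1) : w = 1 := by
  obtain ⟨t, m, n, rfl, hn⟩ := FreeGroup.exists_zpow_of_commute hw
  have h1 := congrArg (fun z => (expSum i z).toAdd) hn
  have h2 := congrArg Multiplicative.toAdd hσ
  simp only [map_zpow, expSum_of_self, toAdd_zpow, toAdd_ofAdd, toAdd_one, smul_eq_mul] at h1 h2
  rcases mul_eq_zero.mp h2 with rfl | h0
  · simp
  · simp [h0] at h1

/-- An endomorphism sending each `x_j` to a conjugate of `x_j ^ n` multiplies exponent sums
by `n`. -/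
theorem expSum_map_of_isConj {r : ℕ} {f : FreeGroup (Fin r) →* FreeGroup (Fin r)} {n : ℤ}
    (hf : ∀ j, IsConj (FreeGroup.of j ^ n) (f (FreeGroup.of j))) (i : Fin r)
    (w : FreeGroup (Fin r)) : expSum i (f w) = expSum i w ^ n := by
  have key : (expSum i).comp f = (zpowGroupHom n).comp (expSum i) := by
    ext j
    have := isConj_iff_eq.mp ((expSum i).map_isConj (hf j))
    simp [← this]
  exact DFunLike.congr_fun key w

/-- Discrete-group form of Lemma 2.2.5(1): `y_i(h⁻¹) = ρ(h⁻¹)(y_i(h)⁻¹)`. -/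
theorem longitude_inv {r : ℕ} {Γ : Type*} [Group Γ]
    (ρ : Γ →* MulAut (FreeGroup (Fin r)))
    (c : Γ → ℤ) (hc : ∀ g, c g ≠ 0)
    (hconj : ∀ (g : Γ) (j : Fin r),
      IsConj (FreeGroup.of j ^ c g) (ρ g (FreeGroup.of j)))
    (y : Γ → Fin r → FreeGroup (Fin r))
    (hy1 : ∀ (g : Γ) (i : Fin r),
      ρ g (FreeGroup.of i) = y g i * FreeGroup.of i ^ c g * (y g i)⁻¹)
    (hy2 : ∀ (g : Γ) (i : Fin r), expSum i (y g i) = 1)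
    (h : Γ) (i : Fin r) :
    y (h⁻¹) i = ρ (h⁻¹) ((y h i)⁻¹) := by
  have hexp : ∀ g w, expSum i (ρ g w) = expSum i w ^ c g := fun g =>
    expSum_map_of_isConj (f := (ρ g).toMonoidHom) (hconj g) i
  have hinv : ∀ w, ρ h⁻¹ (ρ h w) = w := fun w => by simp [← MulAut.mul_apply]
  have hcc : c h * c h⁻¹ = 1 := by
    have := congrArg Multiplicative.toAdd (congrArg (expSum i) (hinv (FreeGroup.of i)))
    simp only [hexp, expSum_of_self, toAdd_zpow, toAdd_ofAdd, smul_eq_mul, mul_one] at this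
    rw [mul_comm, this]
  have hx := hinv (FreeGroup.of i)
  rw [hy1 h, map_mul, map_mul, map_zpow (ρ h⁻¹), hy1 h⁻¹, conj_zpow, ← zpow_mul, mul_comm (c h⁻¹), hcc,
    zpow_one, map_inv (ρ h⁻¹)] at hx
  have hw : ρ h⁻¹ (y h i) * y h⁻¹ i = 1 := by
    refine eq_one_of_commute_of_expSum_eq_one (i := i) ?_ (by rw [map_mul, hexp, hy2, hy2, one_zpow, one_mul])
    rw [commute_iff_eq, ← mul_inv_eq_iff_eq_mul, mul_inv_rev]
    simpa only [mul_assoc] using hx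
  rw [map_inv (ρ h⁻¹)]
  exact eq_inv_of_mul_eq_one_right hw
end

section
/- For all g, h ∈ Γ and every index i, the preferred longitudes satisfy the cocycle property y_i(hg) = ρ(h)(y_i(g)) · y_i(h). (Discrete-group form of Lemma 2.2.5(2).) -/
namespace FreeGroup

theorem mem_zpowers_of_commute_of {α : Type*} [DecidableEq α] {a : α} {w : FreeGroup α}
    (hw : Commute w (of a)) : w ∈ Subgroup.zpowers (of a) := by
  induction hn : w.norm using Nat.strong_induction_on generalizing w with
  | _ n ih =>
    have hred : IsReduced w.toWord := isReduced_toWord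
    have hmk : mk w.toWord = w := mk_toWord
    rcases hL : w.toWord with _ | ⟨⟨b, e⟩, L⟩
    · rw [toWord_eq_nil_iff.mp hL]
      exact one_mem _
    rw [hL] at hred hmk
    have hsplit : w = mk [(b, e)] * mk L := by
      rw [mul_mk, ← hmk]
      rfl
    by_cases hb : b = a
    · subst hb
      have hletter : mk [(b, e)] ∈ Subgroup.zpowers (of b) := by
        cases e with
        | true => exact Subgroup.mem_zpowers (of b)
        | false => exact inv_mem (Subgroup.mem_zpowers (of b))
      have hcomm : Commute (mk [(b, e)]) (of b) := by
        obtain ⟨k, hk⟩ := hletter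
        rw [← hk]
        exact (Commute.refl (of b)).zpow_left k
      have hrest : mk L = (mk [(b, e)])⁻¹ * w := by rw [hsplit]; group
      have hlt : (mk L).norm < n := by
        have h1 : (mk L).norm ≤ L.length := norm_mk_le
        have h2 : w.norm = L.length + 1 := by rw [norm, hL]; rfl
        omega
      rw [hsplit]
      refine mul_mem hletter (ih _ hlt ?_ rfl)
      rw [hrest]
      exact hcomm.inv_left.mul_left hw
    · exfalso
      have hleft : (of a * w).toWord = (a, true) :: (b, e) :: L := by
        rw [toWord_mul, hL, toWord_of]
        refine IsReduced.reduce_eq ?_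
        exact List.isChain_cons_cons.mpr ⟨fun h => absurd h.symm hb, hred⟩
      have hsub := toWord_mul_sublist w (of a)
      rw [hw.eq, hleft, hL, toWord_of] at hsub
      have heq := hsub.eq_of_length (by simp)
      simp only [List.cons_append, List.cons.injEq, Prod.mk.injEq] at heq
      exact hb heq.1.1.symm

theorem mem_zpowers_of_commute_of_zpow {α : Type*} [DecidableEq α] {a : α} {w : FreeGroup α}
    {n : ℤ} (hn : n ≠ 0) (hw : Commute w (of a ^ n)) : w ∈ Subgroup.zpowers (of a) := by
  refine mem_zpowers_of_commute_of ?_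
  have h : (w * of a * w⁻¹) ^ n = of a ^ n := by
    rw [conj_zpow, hw.eq, mul_inv_cancel_right]
  exact mul_inv_eq_iff_eq_mul.mp ((zpow_left_inj hn).mp h)

end FreeGroup

theorem ofAdd_one_zpow_injective :
    Function.Injective fun n : ℤ => (Multiplicative.ofAdd (1 : ℤ)) ^ n := by
  intro m n h
  simpa [← ofAdd_zsmul] using h

theorem eq_one_of_mem_zpowers_of_expSum_eq_one {r : ℕ} {i : Fin r} {w : FreeGroup (Fin r)}
    (hw : w ∈ Subgroup.zpowers (FreeGroup.of i)) (h : expSum i w = 1) : w = 1 := by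
  obtain ⟨k, rfl⟩ := hw
  have hk : k = 0 := ofAdd_one_zpow_injective (by simpa [expSum_of_self] using h)
  simp [hk]

theorem eq_of_conj_zpow_eq {r : ℕ} {i : Fin r} {u v : FreeGroup (Fin r)} {n : ℤ} (hn : n ≠ 0)
    (h : u * FreeGroup.of i ^ n * u⁻¹ = v * FreeGroup.of i ^ n * v⁻¹)
    (huv : expSum i u = expSum i v) : u = v := by
  have hcomm : Commute (v⁻¹ * u) (FreeGroup.of i ^ n) := by
    have h' := congrArg (fun z => v⁻¹ * z * u) h
    simpa [Commute, SemiconjBy, mul_assoc] using h'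
  have h1 := eq_one_of_mem_zpowers_of_expSum_eq_one
    (FreeGroup.mem_zpowers_of_commute_of_zpow hn hcomm) (by simp [huv])
  exact (inv_mul_eq_one.mp h1).symm

theorem expSum_apply_of_forall_conj {r : ℕ} {φ : FreeGroup (Fin r) →* FreeGroup (Fin r)} {n : ℤ}
    (hφ : ∀ j, IsConj (FreeGroup.of j ^ n) (φ (FreeGroup.of j)))
    (i : Fin r) (w : FreeGroup (Fin r)) : expSum i (φ w) = expSum i w ^ n := by
  have hhom : (expSum i).comp φ = (zpowGroupHom n).comp (expSum i) := by
    refine FreeGroup.ext_hom _ _ fun j => ?_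
    have hj := isConj_iff_eq.mp ((expSum i).map_isConj (hφ j))
    simpa using hj.symm
  exact DFunLike.congr_fun hhom w

/-- Discrete-group form of Lemma 2.2.5(2): the cocycle property
`y_i(hg) = ρ(h)(y_i(g)) · y_i(h)`. -/
theorem longitude_cocycle {r : ℕ} {Γ : Type*} [Group Γ]
    (ρ : Γ →* MulAut (FreeGroup (Fin r)))
    (c : Γ → ℤ) (hc : ∀ g, c g ≠ 0)
    (hconj : ∀ (g : Γ) (j : Fin r),
      IsConj (FreeGroup.of j ^ c g) (ρ g (FreeGroup.of j)))
    (y : Γ → Fin r → FreeGroup (Fin r))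
    (hy1 : ∀ (g : Γ) (i : Fin r),
      ρ g (FreeGroup.of i) = y g i * FreeGroup.of i ^ c g * (y g i)⁻¹)
    (hy2 : ∀ (g : Γ) (i : Fin r), expSum i (y g i) = 1)
    (g h : Γ) (i : Fin r) :
    y (h * g) i = ρ h (y g i) * y h i := by
  have hσ := expSum_apply_of_forall_conj (φ := (ρ h).toMonoidHom) (hconj h)
  have hcomp : ρ (h * g) (FreeGroup.of i) = (ρ h (y g i) * y h i) *
      FreeGroup.of i ^ (c h * c g) * (ρ h (y g i) * y h i)⁻¹ := by
    rw [map_mul, MulAut.mul_apply, hy1 g i, map_mul, map_mul, map_zpow, map_inv, hy1 h i,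
      conj_zpow, zpow_mul]
    group
  have hc_mul : c (h * g) = c h * c g := by
    have h1 := congrArg (expSum i) ((hy1 (h * g) i).symm.trans hcomp)
    refine ofAdd_one_zpow_injective ?_
    simpa only [map_mul, map_inv, map_zpow, expSum_of_self, mul_inv_cancel_comm] using h1
  refine eq_of_conj_zpow_eq (i := i) (hc (h * g)) ?_ ?_
  · rw [← hy1, hcomp, hc_mul]
  · have h2 : expSum i (ρ h (y g i)) = 1 := by
      simpa [hy2] using hσ i (y g i)
    rw [map_mul, h2, hy2, hy2, mul_one]
end

section
/- Let r ≥ 2, let F_r be the free group on x_1, …, x_r, set x_{r+1} := (x_1⋯x_r)⁻¹, and let 𝔎 be the subgroup of F_r generated by the commutator subgroup [F_r, F_r] together with x_1, …, x_{r−2}. Suppose f ∈ F_r and N ∈ ℤ satisfy f·x_{r+1}·f⁻¹ = x_{r+1}^N, and suppose there exists g ∈ 𝔎 with f·x_r·f⁻¹ = g·x_r·g⁻¹. Then N = 1 and f = 1. (Injectivity part of Proposition 1.2.2 on Bely̆ı lifts, stated for the free group.) -/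
namespace FreeGroup

variable {α : Type*}

/-- The exponent sum of the generator `a`. -/
def exponentSum [DecidableEq α] (a : α) : FreeGroup α →* Multiplicative ℤ :=
  lift fun b => if b = a then Multiplicative.ofAdd 1 else 1

@[simp]
theorem exponentSum_of [DecidableEq α] (a b : α) :
    exponentSum a (of b) = if b = a then Multiplicative.ofAdd 1 else 1 :=
  lift_apply_of

theorem exponentSum_prod_ofFn {r : ℕ} (j : Fin r) :
    exponentSum j (List.ofFn fun i : Fin r => of i).prod = Multiplicative.ofAdd 1 := by
  rw [map_list_prod, List.map_ofFn, List.prod_ofFn]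
  simp

/-- A nonempty reduced word commuting with a generator starts with it or its inverse. -/
theorem head_eq_of_commute [DecidableEq α] {a b : α} {s : Bool} {L : List (α × Bool)}
    (hL : IsReduced ((b, s) :: L)) (h : Commute (mk ((b, s) :: L)) (of a)) : b = a := by
  by_contra hne
  have hred : IsReduced ((a, true) :: (b, s) :: L) :=
    isReduced_cons_cons.2 ⟨fun hab => absurd hab.symm hne, hL⟩
  have hmk : mk ((b, s) :: L ++ [(a, true)]) = mk ((a, true) :: (b, s) :: L) := by
    have := h.eq
    rwa [of, mul_mk, mul_mk] at this
  have hreduce := reduce.sound hmk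
  rw [hred.reduce_eq] at hreduce
  have hsub : ((a, true) :: (b, s) :: L).Sublist ((b, s) :: L ++ [(a, true)]) := by
    rw [← hreduce]
    exact reduce.red.sublist
  have heq := hsub.eq_of_length (by simp)
  simp only [List.cons_append, List.cons.injEq, Prod.mk.injEq] at heq
  exact hne heq.1.1.symm

/-- The centralizer of a generator of a free group consists of its powers. -/
theorem exists_eq_zpow_of_commute_of {a : α} {f : FreeGroup α} (h : Commute f (of a)) :
    ∃ k : ℤ, f = of a ^ k := by
  classical
  suffices H : ∀ (L : List (α × Bool)), IsReduced L → Commute (mk L) (of a) →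
      ∃ k : ℤ, mk L = of a ^ k by
    simpa [mk_toWord] using H f.toWord isReduced_toWord (by rwa [mk_toWord])
  intro L
  induction L with
  | nil => exact fun _ _ => ⟨0, by simp [one_eq_mk]⟩
  | cons x L ih =>
    obtain ⟨b, s⟩ := x
    intro hL hc
    obtain rfl := head_eq_of_commute hL hc
    obtain ⟨e, he⟩ : ∃ e : ℤ, mk [(b, s)] = of b ^ e := by
      cases s
      · exact ⟨-1, by simp [of, inv_mk, invRev]⟩
      · exact ⟨1, by simp [of]⟩
    have hsplit : mk ((b, s) :: L) = of b ^ e * mk L := by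
      rw [← he, mul_mk, List.singleton_append]
    have hmk : mk L = (of b ^ e)⁻¹ * mk ((b, s) :: L) := by
      rw [hsplit, inv_mul_cancel_left]
    have hcL : Commute (mk L) (of b) := by
      rw [hmk]
      exact ((Commute.refl (of b)).zpow_left e).inv_left.mul_left hc
    obtain ⟨k, hk⟩ := ih (hL.infix (List.suffix_cons _ _).isInfix) hcL
    exact ⟨e + k, by rw [hsplit, hk, zpow_add]⟩

/-- The centralizer of the product of all the generators consists of its powers. -/
theorem exists_eq_zpow_of_commute_prod_ofFn {n : ℕ} {f : FreeGroup (Fin (n + 1))}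
    (h : Commute f (List.ofFn fun i : Fin (n + 1) => of i).prod) :
    ∃ k : ℤ, f = (List.ofFn fun i : Fin (n + 1) => of i).prod ^ k := by
  set t : FreeGroup (Fin (n + 1)) := (List.ofFn fun i : Fin n => of i.succ).prod with ht
  have hw : (List.ofFn fun i : Fin (n + 1) => of i).prod = of 0 * t := by
    rw [List.ofFn_succ, List.prod_cons]
  rw [hw] at h ⊢
  let φ : FreeGroup (Fin (n + 1)) →* FreeGroup (Fin (n + 1)) :=
    lift (Fin.cons (of 0 * t) fun i => of i.succ)
  let ψ : FreeGroup (Fin (n + 1)) →* FreeGroup (Fin (n + 1)) :=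
    lift (Fin.cons (of 0 * t⁻¹) fun i => of i.succ)
  have hφt : φ t = t := by
    rw [ht, map_list_prod, List.map_ofFn]
    simp [φ, Function.comp_def]
  have hψt : ψ t = t := by
    rw [ht, map_list_prod, List.map_ofFn]
    simp [ψ, Function.comp_def]
  have hψ : ψ (of 0) = of 0 * t⁻¹ := by simp [ψ]
  have hψw : ψ (of 0 * t) = of 0 := by
    rw [_root_.map_mul, hψt, hψ, inv_mul_cancel_right]
  have hφ : φ (of 0) = of 0 * t := by simp [φ]
  have hφψ : φ.comp ψ = MonoidHom.id _ := by
    ext i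
    refine Fin.cases ?_ (fun i => ?_) i
    · simp [hψ, hφt, hφ]
    · simp [φ, ψ]
  have hc := h.map ψ
  rw [hψw] at hc
  obtain ⟨k, hk⟩ := exists_eq_zpow_of_commute_of hc
  refine ⟨k, ?_⟩
  have := DFunLike.congr_fun hφψ f
  rw [MonoidHom.comp_apply, hk, map_zpow, hφ] at this
  exact this.symm

end FreeGroup

/-- Injectivity part of Proposition 1.2.2 on Belyĭ lifts, stated for the free group:
if `f · x_{r+1} · f⁻¹ = x_{r+1}^N` where `x_{r+1} = (x_1 ⋯ x_r)⁻¹`, and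
`f · x_r · f⁻¹ = g · x_r · g⁻¹` for some `g` in the subgroup `𝔎` generated by the
commutator subgroup together with `x_1, …, x_{r-2}`, then `N = 1` and `f = 1`. -/
theorem belyi_lift_injectivity {r : ℕ} (hr : 2 ≤ r)
    (f : FreeGroup (Fin r)) (N : ℤ)
    (hfix : f * ((List.ofFn fun i : Fin r => FreeGroup.of i).prod)⁻¹ * f⁻¹ =
      (((List.ofFn fun i : Fin r => FreeGroup.of i).prod)⁻¹) ^ N)
    (hg : ∃ g ∈ commutator (FreeGroup (Fin r)) ⊔
        Subgroup.closure (FreeGroup.of '' {j : Fin r | (j : ℕ) < r - 2}),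
      f * FreeGroup.of (⟨r - 1, by omega⟩ : Fin r) * f⁻¹ =
        g * FreeGroup.of (⟨r - 1, by omega⟩ : Fin r) * g⁻¹) :
    N = 1 ∧ f = 1 := by
  obtain ⟨g, hgK, hg⟩ := hg
  have hN : N = 1 := by
    have := congrArg (FreeGroup.exponentSum (⟨0, by omega⟩ : Fin r)) hfix
    rw [map_mul, map_mul, map_zpow, map_inv, map_inv, FreeGroup.exponentSum_prod_ofFn,
      mul_inv_cancel_comm] at this
    have := congrArg Multiplicative.toAdd this
    simp at this
    omega
  refine ⟨hN, ?_⟩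
  rw [hN, zpow_one, mul_inv_eq_iff_eq_mul] at hfix
  have hw : Commute f (List.ofFn fun i : Fin r => FreeGroup.of i).prod :=
    Commute.inv_right_iff.1 hfix
  obtain ⟨k, hk⟩ : ∃ k : ℤ, f = (List.ofFn fun i : Fin r => FreeGroup.of i).prod ^ k := by
    obtain ⟨n, rfl⟩ : ∃ n, r = n + 1 := ⟨r - 1, by omega⟩
    exact FreeGroup.exists_eq_zpow_of_commute_prod_ofFn hw
  have hc : Commute (g⁻¹ * f) (FreeGroup.of (⟨r - 1, by omega⟩ : Fin r)) := by
    rw [mul_inv_eq_iff_eq_mul] at hg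
    rw [Commute, SemiconjBy, mul_assoc, hg]
    group
  obtain ⟨m, hm⟩ := FreeGroup.exists_eq_zpow_of_commute_of hc
  let χ := FreeGroup.exponentSum (⟨r - 2, by omega⟩ : Fin r)
  have hχg : χ g = 1 := by
    refine (sup_le (Abelianization.commutator_subset_ker χ) ?_ : _ ≤ χ.ker) hgK
    rw [Subgroup.closure_le]
    rintro _ ⟨j, hj, rfl⟩
    have hne : j ≠ ⟨r - 2, by omega⟩ := fun h => by simp [h] at hj
    simp [χ, MonoidHom.mem_ker, hne]
  have hχf : χ f = 1 := by
    have hne : r - 1 ≠ r - 2 := by omega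
    simpa [χ, hχg, hne] using congrArg χ hm
  have hk0 : k = 0 := by
    rw [hk, map_zpow, FreeGroup.exponentSum_prod_ofFn] at hχf
    simpa using congrArg Multiplicative.toAdd hχf
  rw [hk, hk0, zpow_zero]
end

section
/- Let r ≥ 2 and set w := u_1⋯u_r ∈ Λ_r, and for each j write w/u_j := ∏_{i≠j} u_i. Let M be the set of r-tuples (λ_1, …, λ_r) ∈ Λ_r^r such that Σ_{j=1}^r λ_j·u_j = 0 and u_i divides λ_j whenever i ≠ j. Then: (a) M = { (μ_1·(w/u_1), …, μ_r·(w/u_r)) | μ_1, …, μ_r ∈ Λ_r with Σ_{j=1}^r μ_j = 0 }; (b) M is a free Λ_r-submodule of Λ_r^r of rank r−1 with basis v_1, …, v_{r−1}, where v_k is the tuple whose k-th entry is −w/u_k, whose (k+1)-st entry is w/u_{k+1}, and whose other entries are 0. (Theorem 4.3.9(1): description of the primitive part 𝔏_r^{prim} under the Blanchfield–Lyndon embedding.) -/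
open Finset

/-- `w/u_j = ∏_{i ≠ j} u_i` in `Λ_r = ℤ_l[[u_1, …, u_r]]`. -/
noncomputable def wDiv (l r : ℕ) [Fact l.Prime] (j : Fin r) :
    MvPowerSeries (Fin r) ℤ_[l] :=
  ∏ i ∈ Finset.univ.erase j, MvPowerSeries.X i

/-- The set `M` of `r`-tuples `(λ_1, …, λ_r)` with `Σ λ_j u_j = 0` and
`u_i ∣ λ_j` whenever `i ≠ j`. -/
def Mprim (l r : ℕ) [Fact l.Prime] : Set (Fin r → MvPowerSeries (Fin r) ℤ_[l]) :=
  {lam | (∑ j, lam j * MvPowerSeries.X j) = 0 ∧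
    ∀ i j, i ≠ j → MvPowerSeries.X i ∣ lam j}

/-- The basis vectors `v_k`: the `k`-th entry is `−w/u_k`, the `(k+1)`-st entry is
`w/u_{k+1}`, and the other entries are `0`. -/
noncomputable def vBasis (l r : ℕ) [Fact l.Prime] (k : Fin (r - 1)) :
    Fin r → MvPowerSeries (Fin r) ℤ_[l] :=
  fun i => if (i : ℕ) = (k : ℕ) then -(wDiv l r i)
    else if (i : ℕ) = (k : ℕ) + 1 then wDiv l r i else 0

theorem MvPowerSeries.X_dvd_of_dvd_X_mul {σ R : Type*} [CommSemiring R] {i j : σ} (hij : i ≠ j)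
    {φ : MvPowerSeries σ R}
    (h : (MvPowerSeries.X i : MvPowerSeries σ R) ∣ MvPowerSeries.X j * φ) :
    (MvPowerSeries.X i : MvPowerSeries σ R) ∣ φ := by
  classical
  rw [MvPowerSeries.X_dvd_iff] at h ⊢
  intro m hm
  have := h (Finsupp.single j 1 + m) (by simp [hm, hij.symm])
  rwa [MvPowerSeries.X_def, MvPowerSeries.coeff_add_monomial_mul, one_mul] at this

theorem MvPowerSeries.prod_X_dvd {σ R : Type*} [CommSemiring R] (s : Finset σ)
    (φ : MvPowerSeries σ R) (h : ∀ i ∈ s, (MvPowerSeries.X i : MvPowerSeries σ R) ∣ φ) :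
    (∏ i ∈ s, (MvPowerSeries.X i : MvPowerSeries σ R)) ∣ φ := by
  classical
  induction s using Finset.induction_on generalizing φ with
  | empty => simp
  | insert a s ha ih =>
    obtain ⟨ψ, rfl⟩ := h a (Finset.mem_insert_self a s)
    rw [Finset.prod_insert ha]
    refine mul_dvd_mul_left _ (ih ψ fun i hi => ?_)
    exact MvPowerSeries.X_dvd_of_dvd_X_mul (ne_of_mem_of_not_mem hi ha)
      (h i (Finset.mem_insert_of_mem hi))

theorem sum_range_consecutive_difference {R : Type*} [CommRing R] (k m : ℕ) :
    ∑ i ∈ Finset.range (m + 1), (if i = k then (-1 : R) else if i = k + 1 then 1 else 0) =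
      if m = k then -1 else 0 := by
  induction m with
  | zero => simp
  | succ m ih =>
    rw [Finset.sum_range_succ, ih]
    split_ifs <;> first | omega | simp

theorem eq_sum_consecutive_difference_iff {R : Type*} [CommRing R] (n : ℕ) (μ : ℕ → R)
    (hμ : ∑ i ∈ Finset.range (n + 1), μ i = 0) (c : Fin n → R) :
    (∀ i < n + 1, μ i = ∑ k : Fin n,
      c k * (if i = (k : ℕ) then -1 else if i = (k : ℕ) + 1 then 1 else 0)) ↔
    c = fun k : Fin n => -∑ i ∈ Finset.range ((k : ℕ) + 1), μ i := by
  have partial_sum (m : ℕ) : ∑ i ∈ Finset.range (m + 1), ∑ k : Fin n,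
      c k * (if i = (k : ℕ) then -1 else if i = (k : ℕ) + 1 then 1 else 0) =
      ∑ k : Fin n, c k * (if m = (k : ℕ) then -1 else 0) := by
    rw [Finset.sum_comm]
    simp_rw [← Finset.mul_sum, sum_range_consecutive_difference]
  have partial_sum_fin (k : Fin n) :
      ∑ j : Fin n, c j * (if (k : ℕ) = (j : ℕ) then -1 else 0) = -c k := by
    simp [← Fin.ext_iff]
  constructor
  · intro h
    funext k
    rw [Finset.sum_congr rfl fun i hi =>
      h i (by have := Finset.mem_range.mp hi; omega), partial_sum, partial_sum_fin, neg_neg]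
  · intro h
    have key : ∀ m ≤ n + 1, ∑ i ∈ Finset.range m, μ i = ∑ i ∈ Finset.range m, ∑ k : Fin n,
        c k * (if i = (k : ℕ) then -1 else if i = (k : ℕ) + 1 then 1 else 0) := by
      rintro (_ | m) hm
      · simp
      rw [partial_sum]
      rcases Nat.lt_or_ge m n with hmn | hmn
      · have hc := congrFun h ⟨m, hmn⟩
        have hp := partial_sum_fin ⟨m, hmn⟩
        simp only at hc hp
        rw [hp, hc, neg_neg]
      · obtain rfl : m = n := by omega
        rw [hμ]
        refine (Finset.sum_eq_zero fun k _ => ?_).symm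
        rw [if_neg k.isLt.ne', mul_zero]
    intro i hi
    have h1 := key (i + 1) hi
    rw [Finset.sum_range_succ, Finset.sum_range_succ, key i hi.le] at h1
    exact add_left_cancel h1

theorem wDiv_mul_X (l r : ℕ) [Fact l.Prime] (j : Fin r) :
    wDiv l r j * MvPowerSeries.X j = ∏ i, MvPowerSeries.X i :=
  Finset.prod_erase_mul _ _ (Finset.mem_univ j)

theorem MvPowerSeries.X_ne_zero' {σ R : Type*} [CommSemiring R] [Nontrivial R] (i : σ) :
    (MvPowerSeries.X i : MvPowerSeries σ R) ≠ 0 := fun h => by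
  classical
  have := MvPowerSeries.coeff_index_single_self_X (R := R) i
  simp [h] at this

theorem wDiv_ne_zero (l r : ℕ) [Fact l.Prime] (j : Fin r) : wDiv l r j ≠ 0 :=
  Finset.prod_ne_zero_iff.mpr fun i _ => MvPowerSeries.X_ne_zero' i

theorem mem_Mprim_iff (l r : ℕ) [Fact l.Prime] (lam : Fin r → MvPowerSeries (Fin r) ℤ_[l]) :
    lam ∈ Mprim l r ↔ ∃ μ : Fin r → MvPowerSeries (Fin r) ℤ_[l],
      (∑ j, μ j) = 0 ∧ ∀ j, lam j = μ j * wDiv l r j := by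
  have sum_eq (μ : Fin r → MvPowerSeries (Fin r) ℤ_[l]) :
      ∑ j, μ j * wDiv l r j * MvPowerSeries.X j = (∑ j, μ j) * ∏ i, MvPowerSeries.X i := by
    simp_rw [mul_assoc, wDiv_mul_X, Finset.sum_mul]
  constructor
  · rintro ⟨hsum, hdvd⟩
    have (j : Fin r) : ∃ ν, lam j = ν * wDiv l r j := by
      obtain ⟨ν, hν⟩ := MvPowerSeries.prod_X_dvd (Finset.univ.erase j) (lam j)
        fun i hi => hdvd i j (Finset.ne_of_mem_erase hi)
      exact ⟨ν, by rw [hν, mul_comm]; rfl⟩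
    choose μ hμ using this
    refine ⟨μ, ?_, hμ⟩
    simp_rw [hμ] at hsum
    rw [sum_eq] at hsum
    exact (mul_eq_zero.mp hsum).resolve_right
      (Finset.prod_ne_zero_iff.mpr fun i _ => MvPowerSeries.X_ne_zero' i)
  · rintro ⟨μ, hμ, hlam⟩
    obtain rfl : lam = fun j => μ j * wDiv l r j := funext hlam
    refine ⟨by rw [sum_eq, hμ, zero_mul], fun i j hij => Dvd.dvd.mul_left ?_ _⟩
    exact Finset.dvd_prod_of_mem _ (Finset.mem_erase.mpr ⟨hij, Finset.mem_univ i⟩)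

theorem vBasis_apply (l r : ℕ) [Fact l.Prime] (k : Fin (r - 1)) (i : Fin r) :
    vBasis l r k i =
      (if (i : ℕ) = (k : ℕ) then -1 else if (i : ℕ) = (k : ℕ) + 1 then 1 else 0) *
        wDiv l r i := by
  unfold vBasis
  split_ifs <;> simp

theorem vBasis_mem_Mprim (l r : ℕ) [Fact l.Prime] (k : Fin (r - 1)) :
    vBasis l r k ∈ Mprim l r := by
  refine (mem_Mprim_iff l r _).mpr ⟨_, ?_, vBasis_apply l r k⟩
  obtain ⟨n, rfl⟩ : ∃ n, r = n + 1 := ⟨r - 1, by have := k.isLt; omega⟩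
  rw [Fin.sum_univ_eq_sum_range (fun i : ℕ =>
    if i = (k : ℕ) then (-1 : MvPowerSeries (Fin (n + 1)) ℤ_[l])
      else if i = (k : ℕ) + 1 then 1 else 0), sum_range_consecutive_difference,
    if_neg (by have := k.isLt; omega)]

/-- Theorem 4.3.9(1): (a) `M` consists exactly of the tuples `(μ_j · w/u_j)_j` with
`Σ μ_j = 0`; (b) `M` is a free `Λ_r`-module of rank `r−1` on the basis
`v_1, …, v_{r−1}`. -/
theorem primitive_part_description (l : ℕ) [Fact l.Prime] (r : ℕ) (hr : 2 ≤ r) :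
    (Mprim l r = {lam | ∃ μ : Fin r → MvPowerSeries (Fin r) ℤ_[l],
        (∑ j, μ j) = 0 ∧ ∀ j, lam j = μ j * wDiv l r j}) ∧
    (∀ k : Fin (r - 1), vBasis l r k ∈ Mprim l r) ∧
    (∀ lam ∈ Mprim l r, ∃! cc : Fin (r - 1) → MvPowerSeries (Fin r) ℤ_[l],
        lam = ∑ k, cc k • vBasis l r k) := by
  refine ⟨Set.ext (mem_Mprim_iff l r), vBasis_mem_Mprim l r, fun lam hlam => ?_⟩
  obtain ⟨μ, hμ, hlam⟩ := (mem_Mprim_iff l r lam).mp hlam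
  obtain ⟨n, rfl⟩ : ∃ n, r = n + 1 := ⟨r - 1, by omega⟩
  let ν : ℕ → MvPowerSeries (Fin (n + 1)) ℤ_[l] := fun i => if h : i < n + 1 then μ ⟨i, h⟩ else 0
  have hν (i : Fin (n + 1)) : ν i = μ i := dif_pos i.isLt
  have hν_sum : ∑ i ∈ Finset.range (n + 1), ν i = 0 := by
    rw [← Fin.sum_univ_eq_sum_range, ← hμ]
    exact Finset.sum_congr rfl fun i _ => hν i
  have key (c : Fin n → MvPowerSeries (Fin (n + 1)) ℤ_[l]) :
      lam = ∑ k : Fin n, c k • vBasis l (n + 1) k ↔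
        c = fun k : Fin n => -∑ i ∈ Finset.range ((k : ℕ) + 1), ν i := by
    rw [← eq_sum_consecutive_difference_iff n ν hν_sum c, funext_iff, Fin.forall_iff]
    refine forall₂_congr fun i hi => ?_
    rw [hlam, ← hν, Finset.sum_apply]
    simp_rw [Pi.smul_apply, smul_eq_mul, vBasis_apply, ← mul_assoc, ← Finset.sum_mul]
    exact mul_left_inj' (wDiv_ne_zero l (n + 1) ⟨i, hi⟩)
  exact ⟨_, (key _).mpr rfl, fun c hc => (key c).mp hc⟩
end
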